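/- (Intensity function of a GLMB.) Let π be a GLMB density. For every x ∈ 𝕏 and ℓ ∈ 𝕃, the intensity of π at (x,ℓ), defined by the set integral v(x,ℓ) = ∫ π({(x,ℓ)} ∪ X) δX taken over finite subsets X of 𝕏×𝕃 (i.e. v(x,ℓ) = ∑_{n=0}^∞ (1/n!) ∑_{ℓ₁,…,ℓₙ} ∫_{𝕏ⁿ} π({(x,ℓ),(x₁,ℓ₁),…,(xₙ,ℓₙ)}) d(x₁,…,xₙ)), is given in closed form by v(x,ℓ) = ∑_{c∈ℂ} p^(c)(x,ℓ) ∑_{L⊆𝕃} 1_L(ℓ) w^(c)(L), where 1_L(ℓ) is 1 if ℓ ∈ L and 0 otherwise. -/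

import Mathlib

open MeasureTheory ENNReal

/-- The Lebesgue integral of a product of functions of separate coordinates is the product of the
integrals. -/
theorem lintegral_fin_prod_eq_prod {E : Type*} [MeasureSpace E]
    [SigmaFinite (volume : Measure E)] (n : ℕ) (f : Fin n → E → ℝ≥0∞)
    (hf : ∀ i, Measurable (f i)) :
    ∫⁻ xs : Fin n → E, ∏ i, f i (xs i) = ∏ i, ∫⁻ x, f i x := by
  induction n with
  | zero => simp [volume_pi]
  | succ n ih =>
    have hmp := (volume_preserving_piFinSuccAbove (fun _ : Fin (n + 1) => E) 0).symm
    rw [← hmp.lintegral_comp_emb (MeasurableEquiv.measurableEmbedding _), Fin.prod_univ_succ,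
      ← ih (fun i => f i.succ) (fun i => hf i.succ)]
    simp only [Fin.prod_univ_succ, MeasurableEquiv.piFinSuccAbove_symm_apply,
      Fin.insertNthEquiv_apply, Fin.insertNth_zero', Fin.cons_zero, Fin.cons_succ]
    exact lintegral_prod_mul (hf 0).aemeasurable
      (Finset.measurable_fun_prod _ fun (i : Fin n) _ =>
        (hf i.succ).comp (measurable_pi_apply i)).aemeasurable

/-- A label set containing `ℓ` and of cardinality `n + 1` is enumerated by exactly `n !` tuples
with first entry `ℓ`; other sets are not enumerated at all. -/
theorem tsum_cons_image_eq {L : Type*} [DecidableEq L] (n : ℕ) (ℓ : L) (J : Finset L)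
    (a : ℝ≥0∞) :
    ∑' ℓs : Fin n → L,
      (if Function.Injective (Fin.cons ℓ ℓs : Fin (n + 1) → L) ∧
        Finset.image (Fin.cons ℓ ℓs : Fin (n + 1) → L) Finset.univ = J then a else 0)
    = if ℓ ∈ J ∧ J.card = n + 1 then (Nat.factorial n : ℝ≥0∞) * a else 0 := by
  have himage (ℓs : Fin n → L) : Finset.image (Fin.cons ℓ ℓs : Fin (n + 1) → L) Finset.univ =
      insert ℓ (Finset.image ℓs Finset.univ) := by
    ext b
    simp [Fin.exists_fin_succ, eq_comm]
  split_ifs with hJ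
  · obtain ⟨hmem, hcard⟩ := hJ
    have hcard' : (J.erase ℓ).card = n := by rw [Finset.card_erase_of_mem hmem, hcard]; rfl
    have hg : Function.Injective
        (fun (e : Fin n ↪ (J.erase ℓ : Finset L)) (i : Fin n) => (e i : L)) := by
      intro e e' h
      ext i
      exact congrFun h i
    rw [← hg.tsum_eq]
    · have hval (e : Fin n ↪ (J.erase ℓ : Finset L)) :
          Function.Injective (Fin.cons ℓ fun i => (e i : L) : Fin (n + 1) → L) ∧
          Finset.image (Fin.cons ℓ fun i => (e i : L) : Fin (n + 1) → L) Finset.univ = J := by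
        have hinj : Function.Injective (Fin.cons ℓ fun i => (e i : L) : Fin (n + 1) → L) := by
          refine Fin.cons_injective_iff.2 ⟨?_, Subtype.val_injective.comp e.injective⟩
          rintro ⟨i, hi⟩
          exact (Finset.mem_erase.1 (e i).2).1 hi
        refine ⟨hinj, Finset.eq_of_subset_of_card_le ?_ ?_⟩
        · rw [himage]
          refine Finset.insert_subset hmem fun b hb => ?_
          obtain ⟨i, -, rfl⟩ := Finset.mem_image.1 hb
          exact Finset.mem_of_mem_erase (e i).2
        · rw [Finset.card_image_of_injective _ hinj, hcard]
          simp
      simp only [hval, and_self, if_true]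
      rw [tsum_fintype, Finset.sum_const, Finset.card_univ, Fintype.card_embedding_eq,
        Fintype.card_coe, hcard', Fintype.card_fin, Nat.descFactorial_self, nsmul_eq_mul]
    · intro ℓs hℓs
      obtain ⟨hinj, him⟩ : Function.Injective (Fin.cons ℓ ℓs : Fin (n + 1) → L) ∧
          Finset.image (Fin.cons ℓ ℓs : Fin (n + 1) → L) Finset.univ = J := by
        by_contra h
        exact hℓs (if_neg h)
      obtain ⟨hnot, hinj'⟩ := Fin.cons_injective_iff.1 hinj
      refine ⟨⟨fun i => ⟨ℓs i, Finset.mem_erase.2 ⟨fun h => hnot ⟨i, h⟩, ?_⟩⟩,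
        fun i j h => hinj' (congrArg Subtype.val h)⟩, rfl⟩
      rw [← him, himage]
      simp
  · refine ENNReal.tsum_eq_zero.2 fun ℓs => if_neg ?_
    rintro ⟨hinj, rfl⟩
    refine hJ ⟨by simp [himage], ?_⟩
    rw [Finset.card_image_of_injective _ hinj]
    simp

/-- Set integral of a function of the label set only, over sets prepended with `ℓ`. -/
theorem tsum_inv_factorial_cons_image {L : Type*} [DecidableEq L] (ℓ : L)
    (G : Finset L → ℝ≥0∞) :
    ∑' n : ℕ, (Nat.factorial n : ℝ≥0∞)⁻¹ * ∑' ℓs : Fin n → L,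
      (if Function.Injective (Fin.cons ℓ ℓs : Fin (n + 1) → L) then
        G (Finset.image (Fin.cons ℓ ℓs : Fin (n + 1) → L) Finset.univ) else 0)
    = ∑' J : Finset L, if ℓ ∈ J then G J else 0 := by
  have hlevel (n : ℕ) : (Nat.factorial n : ℝ≥0∞)⁻¹ * ∑' ℓs : Fin n → L,
      (if Function.Injective (Fin.cons ℓ ℓs : Fin (n + 1) → L) then
        G (Finset.image (Fin.cons ℓ ℓs : Fin (n + 1) → L) Finset.univ) else 0)
      = ∑' J : Finset L, if ℓ ∈ J ∧ J.card = n + 1 then G J else 0 := by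
    have hsplit (ℓs : Fin n → L) :
        (if Function.Injective (Fin.cons ℓ ℓs : Fin (n + 1) → L) then
          G (Finset.image (Fin.cons ℓ ℓs : Fin (n + 1) → L) Finset.univ) else 0)
        = ∑' J : Finset L, if Function.Injective (Fin.cons ℓ ℓs : Fin (n + 1) → L) ∧
            Finset.image (Fin.cons ℓ ℓs : Fin (n + 1) → L) Finset.univ = J then G J else 0 := by
      by_cases h : Function.Injective (Fin.cons ℓ ℓs : Fin (n + 1) → L)
      · simp only [h, true_and, if_true]
        exact (tsum_ite_eq' _ G).symm
      · simp [h]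
    simp_rw [hsplit]
    rw [ENNReal.tsum_comm, ← ENNReal.tsum_mul_left]
    refine tsum_congr fun J => ?_
    rw [tsum_cons_image_eq]
    split_ifs
    · rw [← mul_assoc, ENNReal.inv_mul_cancel (by simp [Nat.factorial_ne_zero]) (by simp),
        one_mul]
    · simp
  simp_rw [hlevel]
  rw [ENNReal.tsum_comm]
  refine tsum_congr fun J => ?_
  by_cases h : ℓ ∈ J
  · obtain ⟨m, hm⟩ := Nat.exists_eq_succ_of_ne_zero (Finset.card_ne_zero_of_mem h)
    simp [h, hm]
  · simp [h]

/-- intensity function of a GLMB.  For a GLMB density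
`π(X) = Δ(X) ∑_c w⁽ᶜ⁾(L(X)) [p⁽ᶜ⁾]^X`, the intensity
`v(x,ℓ) = ∫ π({(x,ℓ)} ∪ X) δX` (the set integral represented by prepending
`(x,ℓ)` to the tuples) is given in closed form by
`v(x,ℓ) = ∑_c p⁽ᶜ⁾(x,ℓ) ∑_{L⊆𝕃} 1_L(ℓ) w⁽ᶜ⁾(L)`. -/
theorem glmb_intensity
    {d : ℕ} {L ι : Type*} [Countable L] [DecidableEq L] [Fintype ι]
    (w : ι → Finset L → ℝ) (hw : ∀ c J, 0 ≤ w c J)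
    (p : ι → (Fin d → ℝ) → L → ℝ)
    (hp0 : ∀ c x ℓ, 0 ≤ p c x ℓ)
    (hpm : ∀ c ℓ, Measurable fun x => p c x ℓ)
    (hp1 : ∀ c ℓ, ∫⁻ x, ENNReal.ofReal (p c x ℓ) = 1)
    (hwsum : ∑' J : Finset L, ∑ c, ENNReal.ofReal (w c J) = 1)
    (x : Fin d → ℝ) (ℓ : L) :
    ∑' n : ℕ, (Nat.factorial n : ℝ≥0∞)⁻¹ *
      ∑' ℓs : Fin n → L,
        ∫⁻ xs : Fin n → (Fin d → ℝ),
          ENNReal.ofReal ((if Function.Injective (Fin.cons ℓ ℓs : Fin (n + 1) → L) then (1:ℝ) else 0) *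
            ∑ c, w c (Finset.image (Fin.cons ℓ ℓs : Fin (n + 1) → L) Finset.univ) *
              ∏ i : Fin (n + 1), p c ((Fin.cons x xs : Fin (n + 1) → (Fin d → ℝ)) i) ((Fin.cons ℓ ℓs : Fin (n + 1) → L) i))
    = ∑ c, ENNReal.ofReal (p c x ℓ) *
        ∑' J : Finset L, (if ℓ ∈ J then (1:ℝ≥0∞) else 0) * ENNReal.ofReal (w c J) := by
  have hint (n : ℕ) (ℓs : Fin n → L) :
      ∫⁻ xs : Fin n → (Fin d → ℝ),
        ENNReal.ofReal ((if Function.Injective (Fin.cons ℓ ℓs : Fin (n + 1) → L)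
            then (1:ℝ) else 0) *
          ∑ c, w c (Finset.image (Fin.cons ℓ ℓs : Fin (n + 1) → L) Finset.univ) *
            ∏ i : Fin (n + 1), p c ((Fin.cons x xs : Fin (n + 1) → (Fin d → ℝ)) i)
              ((Fin.cons ℓ ℓs : Fin (n + 1) → L) i))
      = if Function.Injective (Fin.cons ℓ ℓs : Fin (n + 1) → L) then
          ∑ c, ENNReal.ofReal (w c (Finset.image (Fin.cons ℓ ℓs : Fin (n + 1) → L)
            Finset.univ)) * ENNReal.ofReal (p c x ℓ)
        else 0 := by
    split_ifs with h
    · have hpt (xs : Fin n → (Fin d → ℝ)) :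
          ENNReal.ofReal (1 *
            ∑ c, w c (Finset.image (Fin.cons ℓ ℓs : Fin (n + 1) → L) Finset.univ) *
              ∏ i : Fin (n + 1), p c ((Fin.cons x xs : Fin (n + 1) → (Fin d → ℝ)) i)
                ((Fin.cons ℓ ℓs : Fin (n + 1) → L) i))
          = ∑ c, ENNReal.ofReal
              (w c (Finset.image (Fin.cons ℓ ℓs : Fin (n + 1) → L) Finset.univ)) *
              ENNReal.ofReal (p c x ℓ) * ∏ i, ENNReal.ofReal (p c (xs i) (ℓs i)) := by
        rw [one_mul, ENNReal.ofReal_sum_of_nonneg fun c _ =>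
          mul_nonneg (hw _ _) (Finset.prod_nonneg fun i _ => hp0 _ _ _)]
        refine Finset.sum_congr rfl fun c _ => ?_
        rw [ENNReal.ofReal_mul (hw _ _), ENNReal.ofReal_prod_of_nonneg fun i _ => hp0 _ _ _,
          Fin.prod_univ_succ, mul_assoc]
        simp
      have hmeas (c : ι) : Measurable fun xs : Fin n → (Fin d → ℝ) =>
          ∏ i, ENNReal.ofReal (p c (xs i) (ℓs i)) :=
        Finset.measurable_fun_prod _ fun i _ =>
          ((hpm c (ℓs i)).comp (measurable_pi_apply i)).ennreal_ofReal
      simp_rw [hpt]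
      rw [lintegral_finsetSum _ fun c _ => (hmeas c).const_mul _]
      refine Finset.sum_congr rfl fun c _ => ?_
      rw [lintegral_const_mul _ (hmeas c),
        lintegral_fin_prod_eq_prod n (fun i y => ENNReal.ofReal (p c y (ℓs i)))
          fun i => (hpm c (ℓs i)).ennreal_ofReal]
      simp [hp1]
    · simp
  simp_rw [hint]
  rw [tsum_inv_factorial_cons_image ℓ
    fun J => ∑ c, ENNReal.ofReal (w c J) * ENNReal.ofReal (p c x ℓ)]
  simp_rw [← ENNReal.tsum_mul_left]
  rw [← Summable.tsum_finsetSum fun _ _ => ENNReal.summable]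
  refine tsum_congr fun J => ?_
  split_ifs
  · simp [mul_comm]
  · simp
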